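/- arXiv:0902.2500 — 4 statements merged into one kernel-verified Lean document; each statement's English description precedes it below -/
import Mathlib

section
/- For every m ≥ 2, the m-fold iterated bracket F_m : 𝔤_CM^m → 𝔳, F_m(k₁,…,k_m) := [[⋯[[k₁,k₂],k₃],⋯],k_m], is Hilbert–Schmidt; that is, ‖F_m‖₂² := ∑_{i₁,…,i_m} ‖F_m(h_{i₁},…,h_{i_m})‖²_𝔳 < ∞ for any orthonormal basis {h_i} of 𝔤_CM. Moreover, the bound ‖F_{m+1}‖₂² ≤ N · ‖[·,·]‖₂² · ‖F_m‖₂² holds for all m ≥ 2. -/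
/-- The inclusion of `𝓥` into `𝔤_CM = H ⊕ 𝓥` (with the `ℓ²` direct-sum inner product). -/
noncomputable def vIncl {H 𝓥 : Type*} [NormedAddCommGroup H] [InnerProductSpace ℝ H]
    [NormedAddCommGroup 𝓥] [InnerProductSpace ℝ 𝓥] (v : 𝓥) : WithLp 2 (H × 𝓥) :=
  (WithLp.equiv 2 (H × 𝓥)).symm (0, v)

/-- The `(m+2)`-fold iterated bracket
`F_{m+2}(k₁,…,k_{m+2}) = [[⋯[[k₁,k₂],k₃],⋯],k_{m+2}]`, where the bracket
`br : 𝔤_CM × 𝔤_CM → 𝓥` takes values in `𝓥 ⊆ 𝔤_CM`. -/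
noncomputable def iterBr {H 𝓥 : Type*} [NormedAddCommGroup H] [InnerProductSpace ℝ H]
    [NormedAddCommGroup 𝓥] [InnerProductSpace ℝ 𝓥]
    (br : WithLp 2 (H × 𝓥) →L[ℝ] WithLp 2 (H × 𝓥) →L[ℝ] 𝓥) :
    (m : ℕ) → (Fin (m + 2) → WithLp 2 (H × 𝓥)) → 𝓥
  | 0, k => br (k 0) (k 1)
  | m + 1, k =>
      br (vIncl (iterBr br m (fun i => k i.castSucc))) (k (Fin.last (m + 2)))

section HilbertSchmidt

variable {G W ι : Type*} [NormedAddCommGroup G] [InnerProductSpace ℝ G]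
  [NormedAddCommGroup W] [NormedSpace ℝ W]

/-- A continuous linear map that is square summable on a Hilbert basis has operator norm at most
its Hilbert–Schmidt norm. -/
theorem HilbertBasis.norm_apply_sq_le_tsum (h : HilbertBasis ι ℝ G) (L : G →L[ℝ] W)
    (hL : Summable fun j => ‖L (h j)‖ ^ 2) (x : G) :
    ‖L x‖ ^ 2 ≤ ‖x‖ ^ 2 * ∑' j, ‖L (h j)‖ ^ 2 := by
  have hs : HasSum (fun j => L (h.repr x j • h j)) (L x) := L.hasSum (h.hasSum_repr x)
  refine le_of_tendsto (hs.norm.pow 2) (Filter.Eventually.of_forall fun s => ?_)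
  have hc : ∑ j ∈ s, ‖h.repr x j‖ ^ 2 ≤ ‖x‖ ^ 2 := by
    simpa only [h.repr_apply_apply] using h.orthonormal.sum_inner_products_le x (s := s)
  calc ‖∑ j ∈ s, L (h.repr x j • h j)‖ ^ 2
      ≤ (∑ j ∈ s, ‖h.repr x j‖ * ‖L (h j)‖) ^ 2 := by
        gcongr
        refine (norm_sum_le _ _).trans_eq (Finset.sum_congr rfl fun j _ => ?_)
        rw [map_smul, norm_smul]
    _ ≤ (∑ j ∈ s, ‖h.repr x j‖ ^ 2) * ∑ j ∈ s, ‖L (h j)‖ ^ 2 :=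
        Finset.sum_mul_sq_le_sq_mul_sq _ _ _
    _ ≤ ‖x‖ ^ 2 * ∑' j, ‖L (h j)‖ ^ 2 := by
        gcongr
        exact hL.sum_le_tsum s fun _ _ => by positivity

/-- Fixing the first argument of a Hilbert–Schmidt bilinear map gives a Hilbert–Schmidt map. -/
theorem HilbertBasis.summable_norm_bilin_apply_sq (h : HilbertBasis ι ℝ G)
    (b : G →L[ℝ] G →L[ℝ] W) (hb : Summable fun p : ι × ι => ‖b (h p.1) (h p.2)‖ ^ 2) (x : G) :
    Summable (fun i => ‖b x (h i)‖ ^ 2) ∧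
      ∑' i, ‖b x (h i)‖ ^ 2 ≤ ‖x‖ ^ 2 * ∑' p : ι × ι, ‖b (h p.1) (h p.2)‖ ^ 2 := by
  have hb' : Summable fun p : ι × ι => ‖b (h p.2) (h p.1)‖ ^ 2 := hb.prod_symm
  have hle : ∀ i, ‖b x (h i)‖ ^ 2 ≤ ‖x‖ ^ 2 * ∑' j, ‖b (h j) (h i)‖ ^ 2 := fun i =>
    h.norm_apply_sq_le_tsum (b.flip (h i)) (hb'.prod_factor i) x
  have hsum : Summable fun i => ‖x‖ ^ 2 * ∑' j, ‖b (h j) (h i)‖ ^ 2 := hb'.prod.mul_left _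
  have hx := Summable.of_nonneg_of_le (fun _ => by positivity) hle hsum
  refine ⟨hx, (hx.tsum_le_tsum hle hsum).trans_eq ?_⟩
  rw [tsum_mul_left, ← hb'.tsum_prod,
    ← (Equiv.prodComm ι ι).tsum_eq fun p : ι × ι => ‖b (h p.1) (h p.2)‖ ^ 2]
  rfl

/-- Inserting a square-summable family in the first argument of a Hilbert–Schmidt bilinear map. -/
theorem HilbertBasis.summable_norm_bilin_family_sq {α : Type*} (h : HilbertBasis ι ℝ G)
    (b : G →L[ℝ] G →L[ℝ] W) (hb : Summable fun p : ι × ι => ‖b (h p.1) (h p.2)‖ ^ 2)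
    (u : α → G) (hu : Summable fun a => ‖u a‖ ^ 2) :
    Summable (fun p : ι × α => ‖b (u p.2) (h p.1)‖ ^ 2) ∧
      ∑' p : ι × α, ‖b (u p.2) (h p.1)‖ ^ 2 ≤
        (∑' p : ι × ι, ‖b (h p.1) (h p.2)‖ ^ 2) * ∑' a, ‖u a‖ ^ 2 := by
  have hle := fun a => (h.summable_norm_bilin_apply_sq b hb (u a)).2
  have hsum := hu.mul_right (∑' p : ι × ι, ‖b (h p.1) (h p.2)‖ ^ 2)
  have houter : Summable fun a => ∑' i, ‖b (u a) (h i)‖ ^ 2 :=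
    Summable.of_nonneg_of_le (fun _ => tsum_nonneg fun _ => by positivity) hle hsum
  have hs : Summable fun p : α × ι => ‖b (u p.1) (h p.2)‖ ^ 2 :=
    (summable_prod_of_nonneg fun _ => by positivity).2
      ⟨fun a => (h.summable_norm_bilin_apply_sq b hb (u a)).1, houter⟩
  refine ⟨hs.prod_symm, ?_⟩
  calc ∑' p : ι × α, ‖b (u p.2) (h p.1)‖ ^ 2
      = ∑' p : α × ι, ‖b (u p.1) (h p.2)‖ ^ 2 :=
        (Equiv.prodComm ι α).tsum_eq fun p : α × ι => ‖b (u p.1) (h p.2)‖ ^ 2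
    _ = ∑' a, ∑' i, ‖b (u a) (h i)‖ ^ 2 := hs.tsum_prod
    _ ≤ ∑' a, ‖u a‖ ^ 2 * ∑' p : ι × ι, ‖b (h p.1) (h p.2)‖ ^ 2 :=
        houter.tsum_le_tsum hle hsum
    _ = _ := by rw [tsum_mul_right, mul_comm]

end HilbertSchmidt

section IteratedBracket

variable {H 𝓥 : Type*} [NormedAddCommGroup H] [InnerProductSpace ℝ H]
  [NormedAddCommGroup 𝓥] [InnerProductSpace ℝ 𝓥]

theorem norm_vIncl (v : 𝓥) : ‖(vIncl v : WithLp 2 (H × 𝓥))‖ = ‖v‖ :=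
  WithLp.norm_toLp_snd 2 H 𝓥 v

/-- Adding one more bracket to a square-summable iterated bracket. -/
theorem summable_iterBr_succ {ι : Type*} (h : HilbertBasis ι ℝ (WithLp 2 (H × 𝓥)))
    (br : WithLp 2 (H × 𝓥) →L[ℝ] WithLp 2 (H × 𝓥) →L[ℝ] 𝓥)
    (hbr : Summable fun p : ι × ι => ‖br (h p.1) (h p.2)‖ ^ 2) (m : ℕ)
    (hm : Summable fun t : Fin (m + 2) → ι => ‖iterBr br m (fun i => h (t i))‖ ^ 2) :
    Summable (fun t : Fin (m + 3) → ι => ‖iterBr br (m + 1) (fun i => h (t i))‖ ^ 2) ∧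
      ∑' t : Fin (m + 3) → ι, ‖iterBr br (m + 1) (fun i => h (t i))‖ ^ 2 ≤
        (∑' p : ι × ι, ‖br (h p.1) (h p.2)‖ ^ 2) *
          ∑' t : Fin (m + 2) → ι, ‖iterBr br m (fun i => h (t i))‖ ^ 2 := by
  have key := h.summable_norm_bilin_family_sq br hbr
    (fun t : Fin (m + 2) → ι => vIncl (iterBr br m fun i => h (t i)))
    (by simpa only [norm_vIncl] using hm)
  simp only [norm_vIncl] at key
  let e : ι × (Fin (m + 2) → ι) ≃ (Fin (m + 3) → ι) := Fin.snocEquiv fun _ => ι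
  have he : (fun t : Fin (m + 3) → ι => ‖iterBr br (m + 1) (fun i => h (t i))‖ ^ 2) ∘ e =
      fun p => ‖br (vIncl (iterBr br m fun i => h (p.2 i))) (h p.1)‖ ^ 2 := by
    funext p
    simp [e, iterBr]
  rw [← e.summable_iff, ← e.tsum_eq, he]
  exact ⟨key.1, (tsum_congr fun p => congrFun he p).trans_le key.2⟩

end IteratedBracket

/-- every iterated bracket `F_m : 𝔤_CM^m → 𝓥`, `m ≥ 2`, is Hilbert–Schmidt,
with `‖F_{m+1}‖₂² ≤ N ‖[·,·]‖₂² ‖F_m‖₂²`.  (Here `iterBr br m` is `F_{m+2}`.) -/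
theorem iterated_bracket_hilbert_schmidt
    {H 𝓥 : Type*} [NormedAddCommGroup H] [InnerProductSpace ℝ H] [CompleteSpace H]
    [NormedAddCommGroup 𝓥] [InnerProductSpace ℝ 𝓥] [FiniteDimensional ℝ 𝓥]
    (N : ℕ) (hN : Module.finrank ℝ 𝓥 = N)
    {ι : Type*} (h : HilbertBasis ι ℝ (WithLp 2 (H × 𝓥)))
    (br : WithLp 2 (H × 𝓥) →L[ℝ] WithLp 2 (H × 𝓥) →L[ℝ] 𝓥)
    -- the bracket is Hilbert–Schmidt
    (hbr : Summable (fun p : ι × ι => ‖br (h p.1) (h p.2)‖ ^ 2)) :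
    -- each iterated bracket is Hilbert–Schmidt
    (∀ m : ℕ,
      Summable (fun t : Fin (m + 2) → ι => ‖iterBr br m (fun i => h (t i))‖ ^ 2)) ∧
    -- the bound ‖F_{m+1}‖₂² ≤ N ‖[·,·]‖₂² ‖F_m‖₂² for all m ≥ 2
    (∀ m : ℕ,
      ∑' t : Fin (m + 3) → ι, ‖iterBr br (m + 1) (fun i => h (t i))‖ ^ 2
        ≤ (N : ℝ) * (∑' p : ι × ι, ‖br (h p.1) (h p.2)‖ ^ 2)
          * ∑' t : Fin (m + 2) → ι, ‖iterBr br m (fun i => h (t i))‖ ^ 2) := by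
  have hsum : ∀ m : ℕ,
      Summable (fun t : Fin (m + 2) → ι => ‖iterBr br m (fun i => h (t i))‖ ^ 2) := by
    intro m
    induction m with
    | zero => exact (finTwoArrowEquiv ι).summable_iff.2 hbr
    | succ m ih => exact (summable_iterBr_succ h br hbr m ih).1
  refine ⟨hsum, fun m => ?_⟩
  rcases Nat.eq_zero_or_pos N with rfl | hpos
  · have := Module.finrank_zero_iff.1 hN
    simp [Subsingleton.elim _ (0 : 𝓥)]
  · refine (summable_iterBr_succ h br hbr m (hsum m)).2.trans ?_
    have hN1 : (1 : ℝ) ≤ N := by exact_mod_cast hpos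
    gcongr
    exact le_mul_of_one_le_left (tsum_nonneg fun _ => by positivity) hN1
end

section
/- The Cameron–Martin subspace H is a dense subspace of W. -/
open MeasureTheory

/-- The (extended-real-valued) Cameron–Martin norm
`‖w‖_H := sup{|u(w)|/√(q(u,u)) : u ∈ W*, u ≠ 0}`. -/
noncomputable def cmNormE {W : Type*} [NormedAddCommGroup W] [NormedSpace ℝ W]
    (q : (W →L[ℝ] ℝ) →ₗ[ℝ] (W →L[ℝ] ℝ) →ₗ[ℝ] ℝ) (w : W) : ENNReal :=
  ⨆ u : {u : W →L[ℝ] ℝ // u ≠ 0}, ENNReal.ofReal (|u.1 w| / Real.sqrt (q u.1 u.1))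

open ProbabilityTheory

section CameronMartin

variable {W : Type*} [NormedAddCommGroup W] [NormedSpace ℝ W]

theorem cmNormE_le_iff {q : (W →L[ℝ] ℝ) →ₗ[ℝ] (W →L[ℝ] ℝ) →ₗ[ℝ] ℝ}
    (hpos : ∀ u : W →L[ℝ] ℝ, u ≠ 0 → 0 < q u u) {w : W} {C : ℝ} (hC : 0 ≤ C) :
    cmNormE q w ≤ ENNReal.ofReal C ↔ ∀ u : W →L[ℝ] ℝ, |u w| ≤ C * √(q u u) := by
  simp only [cmNormE, iSup_le_iff, Subtype.forall, ENNReal.ofReal_le_ofReal_iff hC]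
  refine ⟨fun h u ↦ ?_, fun h u hu ↦ ?_⟩
  · rcases eq_or_ne u 0 with rfl | hu
    · simp
    · exact (div_le_iff₀ (Real.sqrt_pos.2 (hpos u hu))).1 (h u hu)
  · exact (div_le_iff₀ (Real.sqrt_pos.2 (hpos u hu))).2 (h u)

theorem cmNormE_ne_top_iff {q : (W →L[ℝ] ℝ) →ₗ[ℝ] (W →L[ℝ] ℝ) →ₗ[ℝ] ℝ}
    (hpos : ∀ u : W →L[ℝ] ℝ, u ≠ 0 → 0 < q u u) {w : W} :
    cmNormE q w ≠ ⊤ ↔ ∃ C : ℝ, 0 ≤ C ∧ ∀ u : W →L[ℝ] ℝ, |u w| ≤ C * √(q u u) := by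
  refine ⟨fun h ↦ ⟨(cmNormE q w).toReal, ENNReal.toReal_nonneg, ?_⟩, fun ⟨C, hC, h⟩ ↦ ?_⟩
  · rw [← cmNormE_le_iff hpos ENNReal.toReal_nonneg, ENNReal.ofReal_toReal h]
  · exact ne_top_of_le_ne_top ENNReal.ofReal_ne_top ((cmNormE_le_iff hpos hC).2 h)

/-- The Cameron–Martin space as a linear subspace. -/
def cameronMartinSubmodule (q : (W →L[ℝ] ℝ) →ₗ[ℝ] (W →L[ℝ] ℝ) →ₗ[ℝ] ℝ)
    (hpos : ∀ u : W →L[ℝ] ℝ, u ≠ 0 → 0 < q u u) : Submodule ℝ W where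
  carrier := {h | cmNormE q h ≠ ⊤}
  zero_mem' := (cmNormE_ne_top_iff hpos).2 ⟨0, le_rfl, by simp⟩
  add_mem' {x y} hx hy := by
    obtain ⟨C, hC, h⟩ := (cmNormE_ne_top_iff hpos).1 hx
    obtain ⟨D, hD, h'⟩ := (cmNormE_ne_top_iff hpos).1 hy
    refine (cmNormE_ne_top_iff hpos).2 ⟨C + D, by positivity, fun u ↦ ?_⟩
    rw [map_add, add_mul]
    exact (abs_add_le _ _).trans (add_le_add (h u) (h' u))
  smul_mem' c x hx := by
    obtain ⟨C, hC, h⟩ := (cmNormE_ne_top_iff hpos).1 hx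
    refine (cmNormE_ne_top_iff hpos).2 ⟨|c| * C, by positivity, fun u ↦ ?_⟩
    rw [map_smul, smul_eq_mul, abs_mul, mul_assoc]
    exact mul_le_mul_of_nonneg_left (h u) (abs_nonneg c)

theorem Submodule.dense_of_forall_dual_eq_zero {p : Submodule ℝ W}
    (hp : ∀ u : W →L[ℝ] ℝ, (∀ x ∈ p, u x = 0) → u = 0) : Dense (p : Set W) := by
  rw [Submodule.dense_iff_topologicalClosure_eq_top, Submodule.eq_top_iff']
  intro x
  by_contra hx
  obtain ⟨f, s, hf, hfx⟩ := geometric_hahn_banach_closed_point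
    (Submodule.convex p.topologicalClosure) p.isClosed_topologicalClosure hx
  have hs : 0 < s := by simpa using hf 0 (zero_mem _)
  have hf0 : f = 0 := by
    refine hp f fun a ha ↦ ?_
    by_contra hne
    have := hf ((s / f a) • a) (p.le_topologicalClosure (p.smul_mem _ ha))
    simp [hne] at this
  simp only [hf0, zero_apply] at hfx
  exact hs.not_gt hfx

variable [MeasurableSpace W] [BorelSpace W]

theorem map_eq_gaussianReal_of_integral_exp {μ : Measure W} [IsProbabilityMeasure μ]
    {q : (W →L[ℝ] ℝ) →ₗ[ℝ] (W →L[ℝ] ℝ) →ₗ[ℝ] ℝ}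
    (hnonneg : ∀ u : W →L[ℝ] ℝ, 0 ≤ q u u)
    (hchar : ∀ u : W →L[ℝ] ℝ,
      ∫ x, Complex.exp (Complex.I * (u x : ℂ)) ∂μ = (Real.exp (-q u u / 2) : ℂ))
    (u : W →L[ℝ] ℝ) : μ.map u = gaussianReal 0 (q u u).toNNReal := by
  have := Measure.isProbabilityMeasure_map (μ := μ) u.measurable.aemeasurable
  refine Measure.ext_of_charFun (funext fun t ↦ ?_)
  rw [charFun_map_eq_charFunDual_smul, charFunDual_apply, charFun_gaussianReal]
  simp_rw [mul_comm _ Complex.I]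
  rw [hchar (t • u), Complex.ofReal_exp]
  congr 1
  simp only [map_smul, LinearMap.smul_apply, smul_eq_mul, Real.coe_toNNReal _ (hnonneg u)]
  push_cast
  ring

/-- A functional `v` takes the value `∫ u v dμ` on the vector `∫ u(x) x dμ(x)`. -/
theorem dual_integral_smul [CompleteSpace W] {μ : Measure W} (hμ : MemLp id 2 μ)
    (u v : W →L[ℝ] ℝ) :
    v (∫ x, u x • x ∂μ) = uncenteredCovarianceBilinDual μ u v := by
  rw [uncenteredCovarianceBilinDual_apply hμ, ← v.integral_comp_comm]
  · simp
  · rw [← memLp_one_iff_integrable]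
    exact hμ.smul (hμ.continuousLinearMap_comp u)

theorem abs_uncenteredCovarianceBilinDual_le (μ : Measure W) (u v : W →L[ℝ] ℝ) :
    |uncenteredCovarianceBilinDual μ u v| ≤
      √(uncenteredCovarianceBilinDual μ u u) * √(uncenteredCovarianceBilinDual μ v v) := by
  have h (w : W →L[ℝ] ℝ) : √(uncenteredCovarianceBilinDual μ w w) = ‖StrongDual.toLp μ 2 w‖ :=
    (norm_eq_sqrt_real_inner (StrongDual.toLp μ 2 w)).symm
  rw [h, h]
  exact abs_real_inner_le_norm (StrongDual.toLp μ 2 u) (StrongDual.toLp μ 2 v)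

theorem uncenteredCovarianceBilinDual_self_of_map_eq_gaussianReal {μ : Measure W}
    (hμ : MemLp id 2 μ) {u : W →L[ℝ] ℝ} {s : NNReal} (hu : μ.map u = gaussianReal 0 s) :
    uncenteredCovarianceBilinDual μ u u = s := by
  have hmean : ∫ x, u x ∂μ = 0 := by
    rw [← integral_id_gaussianReal (μ := 0) (v := s), ← hu,
      integral_map u.measurable.aemeasurable (by fun_prop)]
  rw [uncenteredCovarianceBilinDual_apply hμ]
  have hvar : Var[u; μ] = s := by
    rw [← variance_id_map u.measurable.aemeasurable, hu, variance_id_gaussianReal]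
  rw [← hvar, variance_of_integral_eq_zero u.measurable.aemeasurable hmean]
  simp [sq]

end CameronMartin

/-- the Cameron–Martin subspace `H = {h ∈ W : ‖h‖_H < ∞}` of a Gaussian
measure `μ` on a real separable Banach space `W` is a dense subspace of `W`. -/
theorem cameronMartin_dense_subspace
    {W : Type*} [NormedAddCommGroup W] [NormedSpace ℝ W] [CompleteSpace W]
    [SecondCountableTopology W] [MeasurableSpace W] [BorelSpace W]
    (μ : Measure W) [IsProbabilityMeasure μ]
    (q : (W →L[ℝ] ℝ) →ₗ[ℝ] (W →L[ℝ] ℝ) →ₗ[ℝ] ℝ)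
    (hsymm : ∀ u v : W →L[ℝ] ℝ, q u v = q v u)
    (hpos : ∀ u : W →L[ℝ] ℝ, u ≠ 0 → 0 < q u u)
    -- the characteristic functional of μ: ∫ e^{iu(x)} dμ(x) = e^{-q(u,u)/2}
    (hchar : ∀ u : W →L[ℝ] ℝ,
      ∫ x, Complex.exp (Complex.I * (u x : ℂ)) ∂μ
        = (Real.exp (-q u u / 2) : ℂ)) :
    -- H is a subspace:
    ((0 : W) ∈ {h : W | cmNormE q h ≠ ⊤}) ∧
    (∀ x ∈ {h : W | cmNormE q h ≠ ⊤}, ∀ y ∈ {h : W | cmNormE q h ≠ ⊤},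
      x + y ∈ {h : W | cmNormE q h ≠ ⊤}) ∧
    (∀ (c : ℝ), ∀ x ∈ {h : W | cmNormE q h ≠ ⊤}, c • x ∈ {h : W | cmNormE q h ≠ ⊤}) ∧
    -- H is dense in W:
    Dense {h : W | cmNormE q h ≠ ⊤} := by
  have hnonneg (u : W →L[ℝ] ℝ) : 0 ≤ q u u := by
    rcases eq_or_ne u 0 with rfl | hu
    · simp
    · exact (hpos u hu).le
  have hmap := map_eq_gaussianReal_of_integral_exp hnonneg hchar
  have : IsGaussian μ := isGaussian_of_map_eq_gaussianReal fun u ↦ ⟨_, _, hmap u⟩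
  have hμ : MemLp id 2 μ := IsGaussian.memLp_two_id
  have hself (u : W →L[ℝ] ℝ) : uncenteredCovarianceBilinDual μ u u = q u u := by
    rw [uncenteredCovarianceBilinDual_self_of_map_eq_gaussianReal hμ (hmap u),
      Real.coe_toNNReal _ (hnonneg u)]
  let H := cameronMartinSubmodule q hpos
  refine ⟨H.zero_mem, fun x hx y hy ↦ H.add_mem hx hy, fun c x hx ↦ H.smul_mem c hx,
    Submodule.dense_of_forall_dual_eq_zero (p := H) fun u hu ↦ ?_⟩
  by_contra hne
  refine (hpos u hne).ne' ?_
  rw [← hself u, ← dual_integral_smul hμ u u]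
  refine hu _ ((cmNormE_ne_top_iff hpos).2 ⟨√(q u u), Real.sqrt_nonneg _, fun v ↦ ?_⟩)
  rw [dual_integral_smul hμ u v, ← hself u, ← hself v]
  exact abs_uncenteredCovarianceBilinDual_le μ u v
end

section
/- The second moment C₂ := ∫_W ‖w‖²_W dμ(w) is finite, and for every h ∈ H one has ‖h‖_W ≤ √C₂ · ‖h‖_H. -/
open MeasureTheory

/-- A measure on `W` whose characteristic functional is that of a centered Gaussian with
covariance `q` has centered Gaussian one-dimensional marginals, of variance `q u u`. -/
lemma map_eq_gaussianReal_of_integral_cexp_eq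
    {W : Type*} [NormedAddCommGroup W] [NormedSpace ℝ W] [MeasurableSpace W] [BorelSpace W]
    (μ : Measure W) [IsProbabilityMeasure μ]
    (q : (W →L[ℝ] ℝ) →ₗ[ℝ] (W →L[ℝ] ℝ) →ₗ[ℝ] ℝ)
    (hq : ∀ u : W →L[ℝ] ℝ, 0 ≤ q u u)
    (hchar : ∀ u : W →L[ℝ] ℝ,
      ∫ x, Complex.exp (Complex.I * (u x : ℂ)) ∂μ = (Real.exp (-q u u / 2) : ℂ))
    (u : W →L[ℝ] ℝ) :
    μ.map u = ProbabilityTheory.gaussianReal 0 (q u u).toNNReal := by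
  have hu : Measurable u := u.continuous.measurable
  have := Measure.isProbabilityMeasure_map (μ := μ) hu.aemeasurable
  refine Measure.ext_of_charFun (funext fun t => ?_)
  rw [ProbabilityTheory.charFun_gaussianReal, charFun_apply_real,
    integral_map hu.aemeasurable (by fun_prop)]
  have h := hchar (t • u)
  simp only [map_smul, LinearMap.smul_apply, smul_apply, smul_eq_mul] at h
  convert h using 1
  · congr! 2 with x
    push_cast
    ring_nf
  · push_cast
    rw [Real.coe_toNNReal _ (hq u)]
    ring_nf

/-- The second moment of a continuous functional under a measure with centered Gaussian
marginals. -/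
lemma integral_sq_eq_of_map_eq_gaussianReal
    {W : Type*} [NormedAddCommGroup W] [NormedSpace ℝ W] [MeasurableSpace W] [BorelSpace W]
    (μ : Measure W) (u : W →L[ℝ] ℝ) (v : NNReal)
    (h : μ.map u = ProbabilityTheory.gaussianReal 0 v) :
    ∫ x, u x ^ 2 ∂μ = v := by
  have hu : Measurable u := u.continuous.measurable
  rw [← ProbabilityTheory.variance_id_gaussianReal (μ := 0) (v := v),
    ProbabilityTheory.variance_of_integral_eq_zero aemeasurable_id (by simp), ← h,
    integral_map hu.aemeasurable (by fun_prop)]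
  simp

/-- for a Gaussian measure `μ` on a real separable Banach space `W`, the
second moment `C₂ = ∫ ‖w‖² dμ(w)` is finite, and `‖h‖_W ≤ √C₂ ‖h‖_H` for every `h` in
the Cameron–Martin subspace `H = {h : ‖h‖_H < ∞}`. -/
theorem gaussian_second_moment_and_embedding
    {W : Type*} [NormedAddCommGroup W] [NormedSpace ℝ W] [CompleteSpace W]
    [SecondCountableTopology W] [MeasurableSpace W] [BorelSpace W]
    (μ : Measure W) [IsProbabilityMeasure μ]
    (q : (W →L[ℝ] ℝ) →ₗ[ℝ] (W →L[ℝ] ℝ) →ₗ[ℝ] ℝ)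
    (hsymm : ∀ u v : W →L[ℝ] ℝ, q u v = q v u)
    (hpos : ∀ u : W →L[ℝ] ℝ, u ≠ 0 → 0 < q u u)
    (hchar : ∀ u : W →L[ℝ] ℝ,
      ∫ x, Complex.exp (Complex.I * (u x : ℂ)) ∂μ
        = (Real.exp (-q u u / 2) : ℂ)) :
    -- C₂ < ∞ :
    Integrable (fun w : W => ‖w‖ ^ 2) μ ∧
    -- ‖h‖_W ≤ √C₂ ‖h‖_H for h ∈ H :
    (∀ h : W, cmNormE q h ≠ ⊤ →
      ‖h‖ ≤ Real.sqrt (∫ w, ‖w‖ ^ 2 ∂μ) * (cmNormE q h).toReal) := by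
  have hq (u : W →L[ℝ] ℝ) : 0 ≤ q u u := by
    rcases eq_or_ne u 0 with rfl | hu
    · simp
    · exact (hpos u hu).le
  have hmap := map_eq_gaussianReal_of_integral_cexp_eq μ q hq hchar
  have hgauss : ProbabilityTheory.IsGaussian μ :=
    ProbabilityTheory.isGaussian_of_map_eq_gaussianReal fun u => ⟨0, _, hmap u⟩
  have hint : Integrable (fun w : W => ‖w‖ ^ 2) μ :=
    (ProbabilityTheory.IsGaussian.memLp_two_id (μ := μ)).integrable_norm_pow (by norm_num)
  refine ⟨hint, fun h hh => ?_⟩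
  rcases eq_or_ne h 0 with rfl | h0
  · rw [norm_zero]
    positivity
  obtain ⟨u, hu1, huh⟩ := exists_dual_vector ℝ h (norm_ne_zero_iff.2 h0)
  have hu0 : u ≠ 0 := by
    rintro rfl
    simp at hu1
  have huh' : u h = ‖h‖ := huh
  have hsq : q u u ≤ ∫ w, ‖w‖ ^ 2 ∂μ := by
    have hvar := integral_sq_eq_of_map_eq_gaussianReal μ u _ (hmap u)
    rw [Real.coe_toNNReal _ (hq u)] at hvar
    rw [← hvar]
    refine integral_mono_of_nonneg (.of_forall fun _ => sq_nonneg _) hint (.of_forall fun w => ?_)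
    have hw := u.le_opNorm w
    rw [hu1, one_mul, Real.norm_eq_abs] at hw
    exact sq_le_sq.2 (by rwa [abs_norm])
  have hle : ‖h‖ / √(q u u) ≤ (cmNormE q h).toReal := by
    have hsup : ENNReal.ofReal (|u h| / √(q u u)) ≤ cmNormE q h :=
      le_iSup (fun u : {u : W →L[ℝ] ℝ // u ≠ 0} =>
        ENNReal.ofReal (|u.1 h| / √(q u.1 u.1))) ⟨u, hu0⟩
    rw [huh', abs_norm] at hsup
    exact (ENNReal.ofReal_le_iff_le_toReal hh).1 hsup
  calc ‖h‖ ≤ (cmNormE q h).toReal * √(q u u) :=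
        (div_le_iff₀ (Real.sqrt_pos.2 (hpos u hu0))).1 hle
    _ ≤ (cmNormE q h).toReal * √(∫ w, ‖w‖ ^ 2 ∂μ) := by gcongr
    _ = √(∫ w, ‖w‖ ^ 2 ∂μ) * (cmNormE q h).toReal := mul_comm _ _
end

section
/- If {k_j}_{j=1}^∞ is an orthonormal basis of H and φ : W → C is a bounded linear map into a real Hilbert space C, then ∑_{j=1}^∞ ‖φ(k_j)‖²_C = ∫_W ‖φ(w)‖²_C dμ(w), and this quantity is finite. -/
open MeasureTheory

universe u

open ProbabilityTheory

section HilbertBasis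

variable {E : Type*} [NormedAddCommGroup E] [InnerProductSpace ℝ E]

theorem HilbertBasis.hasSum_sq_inner {ι : Type*} (b : HilbertBasis ι ℝ E) (x : E) :
    HasSum (fun i => inner ℝ (b i) x ^ 2) (‖x‖ ^ 2) := by
  have h := b.hasSum_inner_mul_inner x x
  rw [real_inner_self_eq_norm_sq] at h
  refine h.congr_fun ?_
  intro i
  rw [real_inner_comm, sq]

theorem HilbertBasis.tsum_ofReal_sq_inner {ι : Type*} (b : HilbertBasis ι ℝ E) (x : E) :
    ∑' i, ENNReal.ofReal (inner ℝ (b i) x ^ 2) = ENNReal.ofReal (‖x‖ ^ 2) := by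
  rw [← ENNReal.ofReal_tsum_of_nonneg (fun _ => sq_nonneg _) (b.hasSum_sq_inner x).summable,
    (b.hasSum_sq_inner x).tsum_eq]

theorem Orthonormal.countable_of_separableSpace [TopologicalSpace.SeparableSpace E] {ι : Type*}
    {v : ι → E} (hv : Orthonormal ℝ v) : Countable ι := by
  refine Pairwise.countable_of_isOpen_disjoint (s := fun i => Metric.ball (v i) (1 / 2)) ?_
    (fun _ => Metric.isOpen_ball) (fun i => ⟨v i, Metric.mem_ball_self (by norm_num)⟩)
  intro i j hij
  refine Metric.ball_disjoint_ball ?_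
  have h : ‖v i - v j‖ ^ 2 = 2 := by
    rw [norm_sub_sq_real, hv.1 i, hv.1 j, hv.inner_eq_zero hij]
    norm_num
  rw [dist_eq_norm]
  nlinarith [norm_nonneg (v i - v j)]

end HilbertBasis

section Covariance

variable {W : Type*} [NormedAddCommGroup W] [NormedSpace ℝ W]
  {q : (W →L[ℝ] ℝ) →ₗ[ℝ] (W →L[ℝ] ℝ) →ₗ[ℝ] ℝ}

theorem apply_self_nonneg_of_pos (hpos : ∀ u : W →L[ℝ] ℝ, u ≠ 0 → 0 < q u u) (u : W →L[ℝ] ℝ) :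
    0 ≤ q u u := by
  by_cases hu : u = 0
  · simp [hu]
  · exact (hpos u hu).le

/-- The Cauchy–Schwarz inequality for `q`. -/
theorem abs_apply_le_sqrt_mul_sqrt (hsymm : ∀ u v : W →L[ℝ] ℝ, q u v = q v u)
    (hpos : ∀ u : W →L[ℝ] ℝ, u ≠ 0 → 0 < q u u) (u v : W →L[ℝ] ℝ) :
    |q u v| ≤ √(q u u) * √(q v v) := by
  have hnn := apply_self_nonneg_of_pos hpos
  rw [← Real.sqrt_mul (hnn u), ← Real.sqrt_sq_eq_abs]
  refine Real.sqrt_le_sqrt ?_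
  have h := discrim_le_zero (a := q v v) (b := 2 * q u v) (c := q u u) fun t => by
    have := hnn (u + t • v)
    simp only [map_add, map_smul, LinearMap.add_apply, LinearMap.smul_apply, smul_eq_mul,
      hsymm v u] at this
    linarith
  rw [discrim] at h
  linarith

theorem abs_le_sqrt_mul_of_cmNormE_le (hpos : ∀ u : W →L[ℝ] ℝ, u ≠ 0 → 0 < q u u) {w : W} {r : ℝ}
    (hr : 0 ≤ r) (hw : cmNormE q w ≤ ENNReal.ofReal r) (u : W →L[ℝ] ℝ) :
    |u w| ≤ √(q u u) * r := by
  by_cases hu : u = 0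
  · simp [hu]
  · have h := (ENNReal.ofReal_le_ofReal_iff hr).1 ((iSup_le_iff.1 hw) ⟨u, hu⟩)
    rwa [div_le_iff₀' (Real.sqrt_pos.2 (hpos u hu))] at h

/-- A vector representing `v ↦ q v u` has Cameron–Martin norm at most `√(q u u)`. -/
theorem cmNormE_le_of_forall_apply_eq (hsymm : ∀ u v : W →L[ℝ] ℝ, q u v = q v u)
    (hpos : ∀ u : W →L[ℝ] ℝ, u ≠ 0 → 0 < q u u) {u : W →L[ℝ] ℝ} {w : W}
    (hw : ∀ v : W →L[ℝ] ℝ, v w = q v u) :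
    cmNormE q w ≤ ENNReal.ofReal √(q u u) := by
  refine iSup_le fun v => ENNReal.ofReal_le_ofReal ?_
  rw [div_le_iff₀' (Real.sqrt_pos.2 (hpos v.1 v.2)), hw]
  exact abs_apply_le_sqrt_mul_sqrt hsymm hpos v.1 u

variable [MeasurableSpace W] [BorelSpace W] {μ : Measure W} [IsProbabilityMeasure μ]

theorem map_dual_eq_gaussianReal_of_char (hpos : ∀ u : W →L[ℝ] ℝ, u ≠ 0 → 0 < q u u)
    (hchar : ∀ u : W →L[ℝ] ℝ,
      ∫ x, Complex.exp (Complex.I * (u x : ℂ)) ∂μ = (Real.exp (-q u u / 2) : ℂ))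
    (u : W →L[ℝ] ℝ) : μ.map u = gaussianReal 0 (q u u).toNNReal := by
  have : IsProbabilityMeasure (μ.map u) := Measure.isProbabilityMeasure_map (by fun_prop)
  refine Measure.ext_of_charFun (funext fun t => ?_)
  rw [charFun_gaussianReal, charFun_apply_real, integral_map (by fun_prop) (by fun_prop)]
  have h := hchar (t • u)
  simp only [map_smul, LinearMap.smul_apply, smul_eq_mul, smul_apply,
    Complex.ofReal_mul] at h
  rw [Real.coe_toNNReal _ (apply_self_nonneg_of_pos hpos u)]
  convert h using 1
  · refine integral_congr_ae (.of_forall fun x => ?_)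
    simp only []
    ring_nf
  · push_cast
    ring_nf

theorem isGaussian_of_char (hpos : ∀ u : W →L[ℝ] ℝ, u ≠ 0 → 0 < q u u)
    (hchar : ∀ u : W →L[ℝ] ℝ,
      ∫ x, Complex.exp (Complex.I * (u x : ℂ)) ∂μ = (Real.exp (-q u u / 2) : ℂ)) :
    IsGaussian μ :=
  isGaussian_of_map_eq_gaussianReal fun u =>
    ⟨0, (q u u).toNNReal, map_dual_eq_gaussianReal_of_char hpos hchar u⟩

theorem integral_sq_dual_of_char (hpos : ∀ u : W →L[ℝ] ℝ, u ≠ 0 → 0 < q u u)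
    (hchar : ∀ u : W →L[ℝ] ℝ,
      ∫ x, Complex.exp (Complex.I * (u x : ℂ)) ∂μ = (Real.exp (-q u u / 2) : ℂ))
    (u : W →L[ℝ] ℝ) : ∫ x, u x ^ 2 ∂μ = q u u := by
  have hmap := map_dual_eq_gaussianReal_of_char hpos hchar u
  have h : ∫ y, y ^ 2 ∂(μ.map u) = ∫ x, u x ^ 2 ∂μ :=
    integral_map (by fun_prop) (by fun_prop)
  have hv := variance_id_gaussianReal (μ := 0) (v := (q u u).toNNReal)
  rw [variance_of_integral_eq_zero (by fun_prop) (by simp)] at hv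
  rw [← h, hmap]
  simpa [Real.coe_toNNReal _ (apply_self_nonneg_of_pos hpos u)] using hv

theorem integral_dual_mul_dual_of_char (hsymm : ∀ u v : W →L[ℝ] ℝ, q u v = q v u)
    (hpos : ∀ u : W →L[ℝ] ℝ, u ≠ 0 → 0 < q u u)
    (hchar : ∀ u : W →L[ℝ] ℝ,
      ∫ x, Complex.exp (Complex.I * (u x : ℂ)) ∂μ = (Real.exp (-q u u / 2) : ℂ))
    (u v : W →L[ℝ] ℝ) : ∫ x, u x * v x ∂μ = q u v := by
  have := isGaussian_of_char hpos hchar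
  have hsq := integral_sq_dual_of_char hpos hchar
  have hint : ∀ u : W →L[ℝ] ℝ, Integrable (fun x => u x ^ 2) μ := fun u =>
    (IsGaussian.memLp_dual μ u 2 (by norm_num)).integrable_sq
  have h : ∀ x, u x * v x = ((u + v) x ^ 2 - u x ^ 2 - v x ^ 2) / 2 := fun x => by
    simp only [add_apply]
    ring
  simp_rw [h]
  rw [integral_div, integral_sub (by exact (hint _).sub (hint _)) (hint v),
    integral_sub (hint _) (hint u),
    hsq, hsq, hsq]
  simp only [map_add, LinearMap.add_apply, hsymm v u]
  ring

/-- The vector `∫ x, u x • x ∂μ` represents `v ↦ q v u`. -/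
theorem dual_integral_smul_of_char [CompleteSpace W] [SecondCountableTopology W]
    (hsymm : ∀ u v : W →L[ℝ] ℝ, q u v = q v u)
    (hpos : ∀ u : W →L[ℝ] ℝ, u ≠ 0 → 0 < q u u)
    (hchar : ∀ u : W →L[ℝ] ℝ,
      ∫ x, Complex.exp (Complex.I * (u x : ℂ)) ∂μ = (Real.exp (-q u u / 2) : ℂ))
    (u v : W →L[ℝ] ℝ) : v (∫ x, u x • x ∂μ) = q v u := by
  have := isGaussian_of_char hpos hchar
  have hint : Integrable (fun x => u x • x) μ :=
    memLp_one_iff_integrable.1 <| MemLp.smul (p := 2) (q := 2)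
      (IsGaussian.memLp_two_id (μ := μ)) (IsGaussian.memLp_dual μ u 2 (by norm_num))
  rw [← v.integral_comp_comm hint, ← integral_dual_mul_dual_of_char hsymm hpos hchar]
  refine integral_congr_ae (.of_forall fun x => ?_)
  simp [mul_comm]

theorem hasSum_sq_dual_cameronMartin [CompleteSpace W] [SecondCountableTopology W]
    (hsymm : ∀ u v : W →L[ℝ] ℝ, q u v = q v u)
    (hpos : ∀ u : W →L[ℝ] ℝ, u ≠ 0 → 0 < q u u)
    (hchar : ∀ u : W →L[ℝ] ℝ,
      ∫ x, Complex.exp (Complex.I * (u x : ℂ)) ∂μ = (Real.exp (-q u u / 2) : ℂ))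
    {H : Type*} [NormedAddCommGroup H] [InnerProductSpace ℝ H] [CompleteSpace H]
    (ι : H →ₗ[ℝ] W) (hrange : Set.range ι = {h : W | cmNormE q h ≠ ⊤})
    (hnorm : ∀ h : H, cmNormE q (ι h) = ENNReal.ofReal ‖h‖)
    {J : Type*} (k : HilbertBasis J ℝ H) (u : W →L[ℝ] ℝ) :
    HasSum (fun j => u (ι (k j)) ^ 2) (q u u) := by
  set s := √(q u u)
  have hs : s ^ 2 = q u u := Real.sq_sqrt (apply_self_nonneg_of_pos hpos u)
  have hbound : ∀ h : H, |u (ι h)| ≤ s * ‖h‖ := fun h =>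
    abs_le_sqrt_mul_of_cmNormE_le hpos (norm_nonneg h) (hnorm h).le u
  let f : H →L[ℝ] ℝ := (u.toLinearMap ∘ₗ ι).mkContinuous s hbound
  have hrep := dual_integral_smul_of_char hsymm hpos hchar u
  have hle := cmNormE_le_of_forall_apply_eq hsymm hpos hrep
  obtain ⟨h, hh⟩ : (∫ x, u x • x ∂μ) ∈ Set.range ι :=
    hrange ▸ (hle.trans_lt ENNReal.ofReal_lt_top).ne
  have hhs : ‖h‖ ≤ s := by
    rwa [← hh, hnorm, ENNReal.ofReal_le_ofReal_iff (Real.sqrt_nonneg _)] at hle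
  have hfs : ‖f‖ ≤ s := LinearMap.mkContinuous_norm_le _ (Real.sqrt_nonneg _) _
  have hsf : s ^ 2 ≤ ‖f‖ * s := calc
    s ^ 2 = f h := by rw [hs, ← hrep u, ← hh]; rfl
    _ ≤ ‖f‖ * ‖h‖ := (le_abs_self _).trans (f.le_opNorm h)
    _ ≤ ‖f‖ * s := by gcongr
  let y := (InnerProductSpace.toDual ℝ H).symm f
  have hy : ‖y‖ = ‖f‖ := LinearIsometryEquiv.norm_map _ _
  have hfeq : ‖y‖ ^ 2 = q u u := by
    rw [hy, ← hs]
    have hs0 : 0 ≤ s := Real.sqrt_nonneg _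
    nlinarith [norm_nonneg f, mul_nonneg (norm_nonneg f) (sub_nonneg.2 hfs),
      mul_self_nonneg (s - ‖f‖)]
  rw [← hfeq]
  refine (k.hasSum_sq_inner y).congr_fun fun j => ?_
  rw [real_inner_comm, InnerProductSpace.toDual_symm_apply]
  rfl

end Covariance

/-- if `{k_j}` is an orthonormal basis of the Cameron–Martin space `H` of
a Gaussian measure `μ` on a real separable Banach space `W`, and `φ : W → C` is a bounded
linear map into a real Hilbert space `C`, then
`∑_j ‖φ(k_j)‖² = ∫_W ‖φ(w)‖² dμ(w) < ∞`. -/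
theorem cameronMartin_parseval
    {W : Type} [NormedAddCommGroup W] [NormedSpace ℝ W] [CompleteSpace W]
    [SecondCountableTopology W] [MeasurableSpace W] [BorelSpace W]
    (μ : Measure W) [IsProbabilityMeasure μ]
    (q : (W →L[ℝ] ℝ) →ₗ[ℝ] (W →L[ℝ] ℝ) →ₗ[ℝ] ℝ)
    (hsymm : ∀ u v : W →L[ℝ] ℝ, q u v = q v u)
    (hpos : ∀ u : W →L[ℝ] ℝ, u ≠ 0 → 0 < q u u)
    (hchar : ∀ u : W →L[ℝ] ℝ,
      ∫ x, Complex.exp (Complex.I * (u x : ℂ)) ∂μ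
        = (Real.exp (-q u u / 2) : ℂ))
    -- the Cameron–Martin space H, realized as an abstract Hilbert space Hcm
    -- embedded in W via ι, whose Hilbert norm is the Cameron–Martin norm
    {Hcm : Type} [NormedAddCommGroup Hcm] [InnerProductSpace ℝ Hcm] [CompleteSpace Hcm]
    (ι : Hcm →ₗ[ℝ] W) (hinj : Function.Injective ι)
    (hrange : Set.range ι = {h : W | cmNormE q h ≠ ⊤})
    (hnorm : ∀ h : Hcm, cmNormE q (ι h) = ENNReal.ofReal ‖h‖)
    -- an orthonormal basis {k_j} of H
    (k : HilbertBasis ℕ ℝ Hcm) :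
    ∀ (C : Type u) [NormedAddCommGroup C] [InnerProductSpace ℝ C] [CompleteSpace C]
      (φ : W →L[ℝ] C),
      Integrable (fun w : W => ‖φ w‖ ^ 2) μ ∧
      ∑' j : ℕ, ‖φ (ι (k j))‖ ^ 2 = ∫ w, ‖φ w‖ ^ 2 ∂μ := by
  intro C _ _ _ φ
  have := isGaussian_of_char hpos hchar
  have hint : Integrable (fun w : W => ‖φ w‖ ^ 2) μ :=
    (φ.comp_memLp' (IsGaussian.memLp_two_id (μ := μ))).integrable_norm_pow two_ne_zero
  refine ⟨hint, ?_⟩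
  let K : Submodule ℝ C := φ.range.topologicalClosure
  have : CompleteSpace K := (Submodule.isClosed_topologicalClosure _).completeSpace_coe
  have : TopologicalSpace.SeparableSpace K :=
    (TopologicalSpace.isSeparable_range φ.continuous).closure.separableSpace
  let ψ : W →L[ℝ] K := φ.codRestrict K fun w =>
    Submodule.le_topologicalClosure _ (LinearMap.mem_range_self _ w)
  have hψ : ∀ w, ‖φ w‖ = ‖ψ w‖ := fun _ => rfl
  obtain ⟨I, b, -⟩ := exists_hilbertBasis ℝ K
  have : Countable I := b.orthonormal.countable_of_separableSpace
  let u : I → W →L[ℝ] ℝ := fun i => (innerSL ℝ (b i)).comp ψ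
  have hu : ∀ w, ENNReal.ofReal (‖φ w‖ ^ 2) = ∑' i, ENNReal.ofReal (u i w ^ 2) := fun w => by
    rw [hψ, ← b.tsum_ofReal_sq_inner]
    rfl
  have hui : ∀ i, ∫⁻ w, ENNReal.ofReal (u i w ^ 2) ∂μ
      = ∑' j, ENNReal.ofReal (u i (ι (k j)) ^ 2) := fun i => by
    have hsum := hasSum_sq_dual_cameronMartin hsymm hpos hchar ι hrange hnorm k (u i)
    rw [← ENNReal.ofReal_tsum_of_nonneg (fun _ => sq_nonneg _) hsum.summable, hsum.tsum_eq,
      ← integral_sq_dual_of_char hpos hchar, ofReal_integral_eq_lintegral_ofReal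
        (IsGaussian.memLp_dual μ (u i) 2 (by norm_num)).integrable_sq
        (.of_forall fun _ => sq_nonneg _)]
  have key : ∑' j, ENNReal.ofReal (‖φ (ι (k j))‖ ^ 2) = ∫⁻ w, ENNReal.ofReal (‖φ w‖ ^ 2) ∂μ := by
    simp_rw [hu]
    rw [lintegral_tsum (fun i => by fun_prop), ENNReal.tsum_comm]
    simp_rw [hui]
  rw [integral_eq_lintegral_of_nonneg_ae (.of_forall fun _ => sq_nonneg _)
    hint.aestronglyMeasurable, ← key, ENNReal.tsum_toReal_eq fun _ => ENNReal.ofReal_ne_top]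
  exact tsum_congr fun _ => (ENNReal.toReal_ofReal (sq_nonneg _)).symm
end
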